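/- Let v, v′ be two distinct integers, let p₁ ≥ p₂ ≥ … ≥ p_k ≥ max(5, |v − v′| + 1) be prime numbers, and let λ₁ ∈ 𝔽_{p₁}, …, λ_k ∈ 𝔽_{p_k} be such that λ_i ≠ λ_j whenever p_i = p_j and i ≠ j. Let S = { (T(λ₁−v), …, T(λ_k−v)), (T(λ₁−v′), …, T(λ_k−v′)) } ⊆ PSL₂(p₁) × ⋯ × PSL₂(p_k). Then the subgroup generated by S³S^{−3} = { g₁g₂g₃g₄⁻¹g₅⁻¹g₆⁻¹ : g_i ∈ S } equals the full product PSL₂(p₁) × PSL₂(p₂) × ⋯ × PSL₂(p_k), and likewise for the subgroup generated by S^{−3}S³ = { g₁⁻¹g₂⁻¹g₃⁻¹g₄g₅g₆ : g_i ∈ S }. -/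

import Mathlib

open Matrix
open scoped MatrixGroups

noncomputable section

/-- The transfer matrix `T(μ) = [[μ, -1], [1, 0]]` as an element of `SL(2, ZMod p)`. -/
def Tsl {p : ℕ} (μ : ZMod p) : SL(2, ZMod p) :=
  ⟨!![μ, -1; 1, 0], by simp [Matrix.det_fin_two_of]⟩

/-- The image of `T(μ)` in `PSL(2, ZMod p)`. -/
def Tbar {p : ℕ} (μ : ZMod p) : PSL(2, ZMod p) :=
  QuotientGroup.mk (Tsl μ)

open scoped commutatorElement

/-- Upper unipotent matrices. -/
def Um {p : ℕ} (s : ZMod p) : SL(2, ZMod p) :=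
  ⟨!![1, s; 0, 1], by simp [Matrix.det_fin_two_of]⟩

/-- Lower unipotent matrices. -/
def Lm {p : ℕ} (s : ZMod p) : SL(2, ZMod p) :=
  ⟨!![1, 0; s, 1], by simp [Matrix.det_fin_two_of]⟩

theorem Um_coe {p : ℕ} (s : ZMod p) :
    (Um s : Matrix (Fin 2) (Fin 2) (ZMod p)) = !![1, s; 0, 1] := rfl

theorem Lm_coe {p : ℕ} (s : ZMod p) :
    (Lm s : Matrix (Fin 2) (Fin 2) (ZMod p)) = !![1, 0; s, 1] := rfl

theorem Tsl_coe {p : ℕ} (s : ZMod p) :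
    (Tsl s : Matrix (Fin 2) (Fin 2) (ZMod p)) = !![s, -1; 1, 0] := rfl

theorem Um_mul {p : ℕ} (s t : ZMod p) : Um s * Um t = Um (s + t) := by
  apply Subtype.ext
  simp [Um_coe, Matrix.SpecialLinearGroup.coe_mul, Matrix.mul_fin_two, add_comm]

theorem Lm_mul {p : ℕ} (s t : ZMod p) : Lm s * Lm t = Lm (s + t) := by
  apply Subtype.ext
  simp [Lm_coe, Matrix.SpecialLinearGroup.coe_mul, Matrix.mul_fin_two]

theorem Um_zero {p : ℕ} : Um (0 : ZMod p) = 1 := by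
  apply Subtype.ext
  simp [Um_coe, Matrix.one_fin_two]

theorem Lm_zero {p : ℕ} : Lm (0 : ZMod p) = 1 := by
  apply Subtype.ext
  simp [Lm_coe, Matrix.one_fin_two]

theorem Um_inv {p : ℕ} (s : ZMod p) : (Um s)⁻¹ = Um (-s) := by
  rw [inv_eq_iff_mul_eq_one, Um_mul, add_neg_cancel, Um_zero]

theorem Lm_inv {p : ℕ} (s : ZMod p) : (Lm s)⁻¹ = Lm (-s) := by
  rw [inv_eq_iff_mul_eq_one, Lm_mul, add_neg_cancel, Lm_zero]

theorem Um_pow {p : ℕ} (s : ZMod p) (n : ℕ) : (Um s) ^ n = Um ((n : ZMod p) * s) := by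
  induction n with
  | zero => simp [Um_zero]
  | succ n ih => rw [pow_succ, ih, Um_mul]; congr 1; push_cast; ring

theorem Lm_pow {p : ℕ} (s : ZMod p) (n : ℕ) : (Lm s) ^ n = Lm ((n : ZMod p) * s) := by
  induction n with
  | zero => simp [Lm_zero]
  | succ n ih => rw [pow_succ, ih, Lm_mul]; congr 1; push_cast; ring

theorem exists_nat_mul {p : ℕ} [Fact p.Prime] {t : ZMod p} (ht : t ≠ 0) (s : ZMod p) :
    ∃ n : ℕ, (n : ZMod p) * t = s :=
  ⟨(s / t).val, by rw [ZMod.natCast_zmod_val]; field_simp⟩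

theorem Um_mem {p : ℕ} [Fact p.Prime] {t : ZMod p} (ht : t ≠ 0)
    {D : Subgroup SL(2, ZMod p)} (h : Um t ∈ D) (s : ZMod p) : Um s ∈ D := by
  obtain ⟨n, rfl⟩ := exists_nat_mul ht s
  rw [← Um_pow]; exact D.pow_mem h n

theorem Lm_mem {p : ℕ} [Fact p.Prime] {t : ZMod p} (ht : t ≠ 0)
    {D : Subgroup SL(2, ZMod p)} (h : Lm t ∈ D) (s : ZMod p) : Lm s ∈ D := by
  obtain ⟨n, rfl⟩ := exists_nat_mul ht s
  rw [← Lm_pow]; exact D.pow_mem h n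

theorem mem_of_lower_ne {p : ℕ} [Fact p.Prime] {D : Subgroup SL(2, ZMod p)}
    (hU : ∀ s, Um s ∈ D) (hL : ∀ s, Lm s ∈ D) (g : SL(2, ZMod p)) (hc : g.1 1 0 ≠ 0) :
    g ∈ D := by
  have hdet := g.2
  rw [Matrix.det_fin_two] at hdet
  have : g = Um ((g.1 0 0 - 1) / g.1 1 0) * Lm (g.1 1 0) * Um ((g.1 1 1 - 1) / g.1 1 0) := by
    apply Subtype.ext
    simp only [Um_coe, Lm_coe, Matrix.SpecialLinearGroup.coe_mul, Matrix.mul_fin_two]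
    rw [Matrix.eta_fin_two g.1]
    congr 1
    ext i j
    fin_cases i <;> fin_cases j <;> simp <;> field_simp <;> first | ring1 | linear_combination hdet | linear_combination -hdet
  rw [this]
  exact D.mul_mem (D.mul_mem (hU _) (hL _)) (hU _)

theorem eq_top_of_UL {p : ℕ} [Fact p.Prime] {D : Subgroup SL(2, ZMod p)}
    (hU : ∀ s, Um s ∈ D) (hL : ∀ s, Lm s ∈ D) : D = ⊤ := by
  rw [eq_top_iff]
  intro g _
  by_cases hc : g.1 1 0 = 0
  · have hdet := g.2
    rw [Matrix.det_fin_two, hc] at hdet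
    have ha : g.1 0 0 ≠ 0 := by rintro h; simp [h] at hdet
    have h1 : Lm 1 * g ∈ D := by
      apply mem_of_lower_ne hU hL
      simp [Lm_coe, Matrix.SpecialLinearGroup.coe_mul, Matrix.mul_apply, Fin.sum_univ_two, hc, ha]
    exact (D.mul_mem_cancel_left (hL 1)).1 h1
  · exact mem_of_lower_ne hU hL g hc

/-- The diagonal matrix with entries `2` and `1/2`. -/
theorem exists_diag {p : ℕ} [Fact p.Prime] (hp5 : 5 ≤ p) :
    ∃ d : SL(2, ZMod p), (∀ s, d * Um s * d⁻¹ = Um (4 * s)) ∧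
      (∀ s, d⁻¹ * Lm s * d = Lm (4 * s)) := by
  have h2 : (2 : ZMod p) ≠ 0 := by
    intro h
    have : ((2 : ℕ) : ZMod p) = 0 := by exact_mod_cast h
    rw [ZMod.natCast_eq_zero_iff] at this
    have := Nat.le_of_dvd (by norm_num) this
    omega
  let d : SL(2, ZMod p) := ⟨!![2, 0; 0, 2⁻¹], by simp [Matrix.det_fin_two_of, h2]⟩
  have hd : (d : Matrix (Fin 2) (Fin 2) (ZMod p)) = !![2, 0; 0, 2⁻¹] := rfl
  clear_value d
  refine ⟨d, fun s => ?_, fun s => ?_⟩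
  · rw [mul_inv_eq_iff_eq_mul]
    apply Subtype.ext
    simp [Um_coe, hd, Matrix.SpecialLinearGroup.coe_mul, Matrix.mul_fin_two]
    field_simp; ring
  · rw [mul_assoc, inv_mul_eq_iff_eq_mul]
    apply Subtype.ext
    simp [Lm_coe, hd, Matrix.SpecialLinearGroup.coe_mul, Matrix.mul_fin_two]
    field_simp; ring

theorem SL_perfect {p : ℕ} [Fact p.Prime] (hp5 : 5 ≤ p) :
    commutator SL(2, ZMod p) = ⊤ := by
  obtain ⟨d, hd1, hd2⟩ := exists_diag hp5
  have h3 : (3 : ZMod p) ≠ 0 := by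
    intro h
    have : ((3 : ℕ) : ZMod p) = 0 := by exact_mod_cast h
    rw [ZMod.natCast_eq_zero_iff] at this
    have := Nat.le_of_dvd (by norm_num) this
    omega
  apply eq_top_of_UL
  · apply Um_mem h3
    have : ⁅d, Um 1⁆ = Um (3 : ZMod p) := by
      rw [commutatorElement_def, hd1, Um_inv, Um_mul]; congr 1; norm_num
    rw [← this]
    exact Subgroup.commutator_mem_commutator (Subgroup.mem_top _) (Subgroup.mem_top _)
  · apply Lm_mem h3
    have : ⁅d⁻¹, Lm 1⁆ = Lm (3 : ZMod p) := by
      rw [commutatorElement_def, inv_inv, hd2, Lm_inv, Lm_mul]; congr 1; norm_num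
    rw [← this]
    exact Subgroup.commutator_mem_commutator (Subgroup.mem_top _) (Subgroup.mem_top _)

/-- A normal subgroup containing `[U(c), L(d)]` with `c, d ≠ 0` is everything. -/
theorem normal_eq_top {p : ℕ} [Fact p.Prime] (hp5 : 5 ≤ p) (N : Subgroup SL(2, ZMod p))
    [N.Normal] {c d : ZMod p} (hc : c ≠ 0) (hd : d ≠ 0)
    (h : Um c * Lm d * (Um c)⁻¹ * (Lm d)⁻¹ ∈ N) : N = ⊤ := by
  let π := QuotientGroup.mk' N
  have h0 : π (Um c) * π (Lm d) = π (Lm d) * π (Um c) := by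
    have : π (Um c * Lm d * (Um c)⁻¹ * (Lm d)⁻¹) = 1 := (QuotientGroup.eq_one_iff _).2 h
    simp only [map_mul, map_inv] at this
    rw [mul_inv_eq_one, mul_inv_eq_iff_eq_mul] at this
    exact this
  have h1 : ∀ s r : ZMod p, π (Um s) * π (Lm r) = π (Lm r) * π (Um s) := by
    intro s r
    obtain ⟨n, rfl⟩ := exists_nat_mul hc s
    obtain ⟨m, rfl⟩ := exists_nat_mul hd r
    rw [← Um_pow, ← Lm_pow, map_pow, map_pow]
    exact (Commute.pow_pow (show Commute (π (Um c)) (π (Lm d)) from h0) n m)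
  have hcen : (Subgroup.center _).comap π = ⊤ := by
    apply eq_top_of_UL
    · intro s
      rw [Subgroup.mem_comap, Subgroup.mem_center_iff]
      have : (Subgroup.centralizer {π (Um s)}).comap π = ⊤ := by
        apply eq_top_of_UL
        · intro r
          rw [Subgroup.mem_comap, Subgroup.mem_centralizer_singleton_iff, ← map_mul, ← map_mul,
            Um_mul, Um_mul, add_comm]
        · intro r
          rw [Subgroup.mem_comap, Subgroup.mem_centralizer_singleton_iff]
          exact (h1 s r).symm
      intro g
      obtain ⟨g, rfl⟩ := QuotientGroup.mk'_surjective N g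
      have hg : g ∈ (Subgroup.centralizer {π (Um s)}).comap π := this ▸ Subgroup.mem_top g
      rw [Subgroup.mem_comap, Subgroup.mem_centralizer_singleton_iff] at hg
      exact hg
    · intro s
      rw [Subgroup.mem_comap, Subgroup.mem_center_iff]
      have : (Subgroup.centralizer {π (Lm s)}).comap π = ⊤ := by
        apply eq_top_of_UL
        · intro r
          rw [Subgroup.mem_comap, Subgroup.mem_centralizer_singleton_iff]
          exact (h1 r s)
        · intro r
          rw [Subgroup.mem_comap, Subgroup.mem_centralizer_singleton_iff, ← map_mul, ← map_mul,
            Lm_mul, Lm_mul, add_comm]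
      intro g
      obtain ⟨g, rfl⟩ := QuotientGroup.mk'_surjective N g
      have hg : g ∈ (Subgroup.centralizer {π (Lm s)}).comap π := this ▸ Subgroup.mem_top g
      rw [Subgroup.mem_comap, Subgroup.mem_centralizer_singleton_iff] at hg
      exact hg
  rw [eq_top_iff, ← SL_perfect hp5, commutator_def, Subgroup.commutator_le]
  intro g _ k _
  have hk : k ∈ (Subgroup.center _).comap π := hcen ▸ Subgroup.mem_top k
  rw [Subgroup.mem_comap, Subgroup.mem_center_iff] at hk
  rw [← QuotientGroup.eq_one_iff]
  change π ⁅g, k⁆ = 1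
  rw [map_commutatorElement, commutatorElement_eq_one_iff_mul_comm]
  exact hk _

theorem Tsl_mul_inv {p : ℕ} (a b : ZMod p) : Tsl a * (Tsl b)⁻¹ = Um (a - b) := by
  rw [mul_inv_eq_iff_eq_mul]
  apply Subtype.ext
  simp [Um_coe, Tsl_coe, Matrix.SpecialLinearGroup.coe_mul, Matrix.mul_fin_two]

theorem Tsl_conj {p : ℕ} (a t : ZMod p) :
    Tsl a * Um t * (Tsl a)⁻¹ = Um a * Lm (-t) * (Um a)⁻¹ := by
  rw [Um_inv, mul_inv_eq_iff_eq_mul]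
  apply Subtype.ext
  simp [Um_coe, Lm_coe, Tsl_coe, Matrix.SpecialLinearGroup.coe_mul, Matrix.mul_fin_two]

theorem Tsl_add {p : ℕ} (a c : ZMod p) : Tsl (c + a) = Um c * Tsl a := by
  apply Subtype.ext
  simp [Um_coe, Tsl_coe, Matrix.SpecialLinearGroup.coe_mul, Matrix.mul_fin_two, add_comm]

theorem single_top {p : ℕ} [Fact p.Prime] (D : Subgroup SL(2, ZMod p)) {a t : ZMod p}
    (ht : t ≠ 0) (hU : Um t ∈ D) (hX : Tsl a * Um t * (Tsl a)⁻¹ ∈ D) : D = ⊤ := by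
  have h1 := Um_mem ht hU
  refine eq_top_of_UL h1 (Lm_mem (neg_ne_zero.2 ht) ?_)
  rw [Tsl_conj] at hX
  exact (D.mul_mem_cancel_left (h1 a)).1 ((D.mul_mem_cancel_right (D.inv_mem (h1 a))).1 hX)

/-- The two-coordinate case. -/
theorem pair_top {p q : ℕ} [hpf : Fact p.Prime] [hqf : Fact q.Prime] (hp5 : 5 ≤ p)
    (K : Subgroup (SL(2, ZMod p) × SL(2, ZMod q))) (a b t : ℤ)
    (htp : (t : ZMod p) ≠ 0) (htq : (t : ZMod q) ≠ 0)
    (hab : p = q → (a : ZMod p) ≠ (b : ZMod p))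
    (hU : ((Um (t : ZMod p), Um (t : ZMod q)) : SL(2, ZMod p) × SL(2, ZMod q)) ∈ K)
    (hX : ((Tsl (a : ZMod p), Tsl (b : ZMod q)) : SL(2, ZMod p) × SL(2, ZMod q)) *
      (Um (t : ZMod p), Um (t : ZMod q)) * (Tsl (a : ZMod p), Tsl (b : ZMod q))⁻¹ ∈ K)
    (hY : ((Tsl (a : ZMod p), Tsl (b : ZMod q)) : SL(2, ZMod p) × SL(2, ZMod q)) *
      ((Tsl (a : ZMod p), Tsl (b : ZMod q)) *
      (Um (t : ZMod p), Um (t : ZMod q)) * (Tsl (a : ZMod p), Tsl (b : ZMod q))⁻¹) *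
      (Tsl (a : ZMod p), Tsl (b : ZMod q))⁻¹ ∈ K)
    (x : SL(2, ZMod p)) : ((x, 1) : SL(2, ZMod p) × SL(2, ZMod q)) ∈ K := by
  let N : Subgroup SL(2, ZMod p) := K.comap (MonoidHom.inl _ _)
  have hN : ∀ x, x ∈ N ↔ ((x, 1) : SL(2, ZMod p) × SL(2, ZMod q)) ∈ K := fun x => Iff.rfl
  have hsurj : K.map (MonoidHom.fst _ _) = ⊤ :=
    single_top (a := (a : ZMod p)) _ htp ⟨_, hU, rfl⟩ ⟨_, hX, rfl⟩
  have hnorm : N.Normal := by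
    constructor
    intro n hn g
    obtain ⟨k, hk, rfl⟩ : g ∈ K.map (MonoidHom.fst _ _) := hsurj ▸ Subgroup.mem_top g
    rw [hN] at hn ⊢
    have := K.mul_mem (K.mul_mem hk hn) (K.inv_mem hk)
    convert this using 1
    ext1 <;> simp
  suffices N = ⊤ by rw [← hN, this]; trivial
  by_cases hpq : p = q
  · subst hpq
    have hab := hab rfl
    set c : ZMod p := (a : ZMod p) - b with hc
    have hc0 : c ≠ 0 := sub_ne_zero.2 hab
    have hac : (a : ZMod p) = c + b := by rw [hc]; ring
    rw [hac, Tsl_add] at hX hY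
    generalize hτ : (t : ZMod p) = τ at *
    generalize hβ : (b : ZMod p) = β at *
    -- diagonal unipotents
    have hUU : ∀ s : ZMod p, ((Um s, Um s) : SL(2, ZMod p) × SL(2, ZMod p)) ∈ K := by
      intro s
      exact Um_mem (D := K.comap ((MonoidHom.id _).prod (MonoidHom.id _))) htp hU s
    let φ : SL(2, ZMod p) →* SL(2, ZMod p) × SL(2, ZMod p) :=
      (MulAut.conj (Um c)).toMonoidHom.prod (MonoidHom.id _)
    have hφ : ∀ g, φ g = (Um c * g * (Um c)⁻¹, g) := fun g => rfl
    have hD : K.comap φ = ⊤ := by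
      apply eq_top_of_UL
      · intro s
        rw [Subgroup.mem_comap, hφ, Um_inv, Um_mul, Um_mul]
        convert hUU s using 3
        ring
      · refine Lm_mem (neg_ne_zero.2 htp) ?_
        rw [Subgroup.mem_comap, hφ]
        have := K.mul_mem (K.mul_mem (K.inv_mem (hUU β)) hX) (hUU β)
        convert this using 1
        have e := Tsl_conj β τ
        simp only [Prod.mk_mul_mk, Prod.inv_mk, Prod.mk.injEq]
        constructor
        · rw [_root_.mul_inv_rev, show Um c * Tsl β * Um τ * ((Tsl β)⁻¹ * (Um c)⁻¹)
            = Um c * (Tsl β * Um τ * (Tsl β)⁻¹) * (Um c)⁻¹ by group, e]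
          have hcomm : Um c * Um β = Um β * Um c := by rw [Um_mul, Um_mul, add_comm]
          have : Um c * (Um β * Lm (-τ) * (Um β)⁻¹) * (Um c)⁻¹
            = (Um c * Um β) * Lm (-τ) * (Um c * Um β)⁻¹ := by group
          rw [this, hcomm]; group
        · rw [e]; group
    have h2 : φ (Tsl β * (Tsl β * Um τ * (Tsl β)⁻¹) * (Tsl β)⁻¹) ∈ K := by
      rw [← Subgroup.mem_comap, hD]; trivial
    have h3 := K.mul_mem hY (K.inv_mem h2)
    apply normal_eq_top hp5 N hc0 (neg_ne_zero.2 htp)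
    have h4 : Um c * Tsl β * (Um c * (Tsl β * Um τ * (Tsl β)⁻¹) * (Um c)⁻¹ *
        (Tsl β * Um τ * (Tsl β)⁻¹)⁻¹) * (Um c * Tsl β)⁻¹ ∈ N := by
      rw [hN]
      convert h3 using 1
      rw [hφ]
      simp only [Prod.mk_mul_mk, Prod.inv_mk, Prod.mk.injEq]
      constructor <;> group
    have h5 := (hnorm.mem_comm_iff).1 (by rw [mul_assoc] at h4; exact h4)
    rw [inv_mul_cancel_right] at h5
    rw [Tsl_conj] at h5
    have hcomm : Um c * Um β = Um β * Um c := by rw [Um_mul, Um_mul, add_comm]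
    have h6 := hnorm.conj_mem _ h5 (Um β)⁻¹
    convert h6 using 1
    have : (Um β)⁻¹ * (Um c * (Um β * Lm (-τ) * (Um β)⁻¹) * (Um c)⁻¹ *
      (Um β * Lm (-τ) * (Um β)⁻¹)⁻¹) * (Um β)⁻¹⁻¹ =
      (Um β)⁻¹ * (Um c * Um β) * Lm (-τ) * (Um c * Um β)⁻¹ * Um β * (Lm (-τ))⁻¹ := by group
    rw [this, hcomm]; group
  · have hq0 : (q : ZMod p) ≠ 0 := by
      rw [Ne, ZMod.natCast_eq_zero_iff, Nat.prime_dvd_prime_iff_eq hpf.1 hqf.1]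
      exact hpq
    have hu : Um ((q : ZMod p) * (t : ZMod p)) ∈ N := by
      rw [hN]
      have := K.pow_mem hU q
      rw [Prod.pow_mk, Um_pow, Um_pow] at this
      simpa [Um_zero] using this
    refine normal_eq_top hp5 N (mul_ne_zero hq0 htp) (one_ne_zero) ?_
    rw [mul_assoc, mul_assoc]
    refine N.mul_mem hu ?_
    rw [← mul_assoc]
    exact hnorm.conj_mem _ (N.inv_mem hu) _

/-- Hall's lemma: pairwise full plus perfect implies full. -/
theorem pi_top_of_pairs {ι : Type*} [Fintype ι] [DecidableEq ι] {G : ι → Type*}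
    [∀ i, Group (G i)] (hperf : ∀ i, commutator (G i) = ⊤) (H : Subgroup (∀ i, G i))
    (hs : ∀ i, ∀ x : G i, ∃ h ∈ H, h i = x)
    (hpair : ∀ i j, i ≠ j → ∀ x : G i, ∃ h ∈ H, h i = x ∧ h j = 1) : H = ⊤ := by
  have key : ∀ i, ∀ s : Finset ι, i ∉ s → ∀ x : G i, ∃ h ∈ H, h i = x ∧ ∀ j ∈ s, h j = 1 := by
    intro i s
    induction s using Finset.induction_on with
    | empty => intro _ x; obtain ⟨h, hh, e⟩ := hs i x; exact ⟨h, hh, e, by simp⟩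
    | insert j s hj ih =>
      intro hi x
      simp only [Finset.mem_insert, not_or] at hi
      let M : Subgroup (∀ i, G i) :=
        { carrier := {h | h ∈ H ∧ ∀ l ∈ insert j s, h l = 1}
          one_mem' := ⟨H.one_mem, by simp⟩
          mul_mem' := fun {a b} ha hb => ⟨H.mul_mem ha.1 hb.1, fun l hl => by
            rw [Pi.mul_apply, ha.2 l hl, hb.2 l hl, one_mul]⟩
          inv_mem' := fun {a} ha => ⟨H.inv_mem ha.1, fun l hl => by
            rw [Pi.inv_apply, ha.2 l hl, inv_one]⟩ }
      have hM : M.map (Pi.evalMonoidHom G i) = ⊤ := by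
        rw [eq_top_iff, ← hperf i, commutator_def, Subgroup.commutator_le]
        intro y _ z _
        obtain ⟨h, hh, e1, e2⟩ := ih hi.2 y
        obtain ⟨k, hk, f1, f2⟩ := hpair i j hi.1 z
        refine ⟨⁅h, k⁆, ⟨?_, ?_⟩, ?_⟩
        · rw [commutatorElement_def]
          exact H.mul_mem (H.mul_mem (H.mul_mem hh hk) (H.inv_mem hh)) (H.inv_mem hk)
        · intro l hl
          rw [commutatorElement_def]
          rcases Finset.mem_insert.1 hl with rfl | hl
          · simp [f2]
          · simp [e2 l hl]
        · rw [map_commutatorElement]; simp [e1, f1]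
      obtain ⟨m, hm, e⟩ : x ∈ M.map (Pi.evalMonoidHom G i) := hM ▸ Subgroup.mem_top x
      exact ⟨m, hm.1, e, hm.2⟩
  rw [eq_top_iff]
  intro g _
  apply Subgroup.pi_mem_of_mulSingle_mem
  intro i
  obtain ⟨h, hh, e1, e2⟩ := key i (Finset.univ.erase i) (by simp) (g i)
  convert hh using 1
  funext j
  by_cases hj : j = i
  · subst hj; simp [e1]
  · rw [Pi.mulSingle_eq_of_ne hj, e2 j (by simp [hj])]

theorem SL_main (v v' : ℤ) (hvv' : v ≠ v') (k : ℕ) (p : Fin k → ℕ)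
    (hp : ∀ i, (p i).Prime)
    (hpC : ∀ i, max 5 ((v - v').natAbs + 1) ≤ p i)
    (lam : Fin k → ℤ)
    (hlam : ∀ i j : Fin k, p i = p j → i ≠ j →
      ((lam i : ZMod (p i)) ≠ ((lam j : ℤ) : ZMod (p i))))
    (H : Subgroup (∀ i : Fin k, SL(2, ZMod (p i))))
    (A B : ∀ i : Fin k, SL(2, ZMod (p i)))
    (hA : A = fun i => Tsl ((lam i : ZMod (p i)) - (v : ZMod (p i))))
    (hB : B = fun i => Tsl ((lam i : ZMod (p i)) - (v' : ZMod (p i))))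
    (h1 : A * B⁻¹ ∈ H) (h2 : A * (A * B⁻¹) * A⁻¹ ∈ H)
    (h3 : A * (A * (A * B⁻¹) * A⁻¹) * A⁻¹ ∈ H) : H = ⊤ := by
  have : ∀ i, Fact (p i).Prime := fun i => ⟨hp i⟩
  have hp5 : ∀ i, 5 ≤ p i := fun i => le_trans (le_max_left _ _) (hpC i)
  have ht : ∀ i, ((v' - v : ℤ) : ZMod (p i)) ≠ 0 := by
    intro i h
    rw [ZMod.intCast_zmod_eq_zero_iff_dvd] at h
    have h' := Int.natAbs_dvd_natAbs.2 h
    have := Nat.le_of_dvd (by omega) h'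
    have := le_trans (le_max_right _ _) (hpC i)
    simp only [Int.natAbs_natCast] at *
    omega
  have hAi : ∀ i, A i = Tsl ((lam i - v : ℤ) : ZMod (p i)) := by
    intro i; rw [hA]; push_cast; rfl
  have hu : ∀ i, (A * B⁻¹) i = Um ((v' - v : ℤ) : ZMod (p i)) := by
    intro i
    rw [hA, hB, Pi.mul_apply, Pi.inv_apply, Tsl_mul_inv]
    congr 1; push_cast; ring
  generalize A * B⁻¹ = u at *
  apply pi_top_of_pairs (fun i => SL_perfect (hp5 i))
  · intro i x
    have : H.map (Pi.evalMonoidHom _ i) = ⊤ := by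
      apply single_top (a := ((lam i - v : ℤ) : ZMod (p i))) _ (ht i)
      · exact ⟨u, h1, hu i⟩
      · refine ⟨_, h2, ?_⟩
        rw [← hu, ← hAi]; rfl
    obtain ⟨h, hh, e⟩ : x ∈ H.map (Pi.evalMonoidHom _ i) := this ▸ Subgroup.mem_top x
    exact ⟨h, hh, e⟩
  · intro i j hij x
    let ψ := (Pi.evalMonoidHom (fun i => SL(2, ZMod (p i))) i).prod
      (Pi.evalMonoidHom (fun i => SL(2, ZMod (p i))) j)
    have hψu : ψ u = (Um ((v' - v : ℤ) : ZMod (p i)), Um ((v' - v : ℤ) : ZMod (p j))) := by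
      rw [← hu, ← hu]; rfl
    have hψA : ψ A = (Tsl ((lam i - v : ℤ) : ZMod (p i)), Tsl ((lam j - v : ℤ) : ZMod (p j))) := by
      rw [← hAi, ← hAi]; rfl
    have := pair_top (hp5 i) (H.map ψ) (lam i - v) (lam j - v) (v' - v) (ht i) (ht j)
      (fun e h => hlam i j e hij (by push_cast at h; exact sub_left_injective h))
      (by rw [← hψu]; exact ⟨u, h1, rfl⟩)
      (by rw [← hψu, ← hψA, ← map_inv, ← map_mul, ← map_mul]; exact ⟨_, h2, rfl⟩)
      (by rw [← hψu, ← hψA, ← map_inv, ← map_mul, ← map_mul, ← map_mul, ← map_mul]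
          exact ⟨_, h3, rfl⟩) x
    obtain ⟨h, hh, e⟩ := this
    exact ⟨h, hh, congrArg Prod.fst e, congrArg Prod.snd e⟩

/-- Conjugation by the swap matrix. -/
def swapFun {p : ℕ} (g : SL(2, ZMod p)) : SL(2, ZMod p) :=
  ⟨!![g.1 1 1, g.1 1 0; g.1 0 1, g.1 0 0], by
    have := g.2
    rw [Matrix.det_fin_two] at this
    rw [Matrix.det_fin_two_of]; linear_combination this⟩

theorem swapFun_coe {p : ℕ} (g : SL(2, ZMod p)) :
    (swapFun g : Matrix (Fin 2) (Fin 2) (ZMod p)) =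
      !![g.1 1 1, g.1 1 0; g.1 0 1, g.1 0 0] := rfl

/-- Conjugation by the swap matrix, as a homomorphism. -/
def swapHom (p : ℕ) : SL(2, ZMod p) →* SL(2, ZMod p) where
  toFun := swapFun
  map_one' := by
    apply Subtype.ext
    simp [swapFun_coe, Matrix.one_fin_two]
  map_mul' g h := by
    apply Subtype.ext
    simp [swapFun_coe, Matrix.SpecialLinearGroup.coe_mul, Matrix.mul_apply,
      Fin.sum_univ_two, add_comm]

theorem swapHom_swapHom {p : ℕ} (g : SL(2, ZMod p)) : swapHom p (swapHom p g) = g := by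
  change swapFun (swapFun g) = g
  apply Subtype.ext
  simpa [swapFun_coe] using (Matrix.eta_fin_two g.1).symm

theorem swapHom_Tsl {p : ℕ} (a : ZMod p) : swapHom p (Tsl a) = (Tsl a)⁻¹ := by
  change swapFun (Tsl a) = _
  rw [eq_inv_iff_mul_eq_one]
  apply Subtype.ext
  simp [swapFun_coe, Tsl_coe, Matrix.SpecialLinearGroup.coe_mul, Matrix.one_fin_two]

theorem top_of_comap {G K : Type*} [Group G] [Group K] {f : G →* K}
    (hf : Function.Surjective f) {M : Subgroup K} (h : M.comap f = ⊤) : M = ⊤ := by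
  rw [← Subgroup.map_comap_eq_self_of_surjective hf M, h, Subgroup.map_top_of_surjective f hf]

/-- Let `v, v'` be two distinct integers, let `p 0 ≥ p 1 ≥ … ≥ p (k-1)` be
primes, all `≥ max (5, |v - v'| + 1)`, and let `λ i ∈ 𝔽_{p i}` (given by integer representatives)
be such that `λ i ≠ λ j` whenever `p i = p j` and `i ≠ j`.  Then, with
`S = {(T(λ 0 - v), …, T(λ (k-1) - v)), (T(λ 0 - v'), …, T(λ (k-1) - v'))}` inside
`PSL₂(p 0) × ⋯ × PSL₂(p (k-1))`, the subgroup generated by `S³S⁻³` is the full product, and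
likewise for the subgroup generated by `S⁻³S³`. -/
theorem psl2_product_generation_S3 (v v' : ℤ) (hvv' : v ≠ v') (k : ℕ) (p : Fin k → ℕ)
    (hp : ∀ i, (p i).Prime) (hmono : Antitone p)
    (hpC : ∀ i, max 5 ((v - v').natAbs + 1) ≤ p i)
    (lam : Fin k → ℤ)
    (hlam : ∀ i j : Fin k, p i = p j → i ≠ j →
      ((lam i : ZMod (p i)) ≠ ((lam j : ℤ) : ZMod (p i)))) :
    (Subgroup.closure {x : ∀ i : Fin k, PSL(2, ZMod (p i)) |
        ∃ g₁ ∈ ({fun i => Tbar ((lam i : ZMod (p i)) - (v : ZMod (p i))),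
                  fun i => Tbar ((lam i : ZMod (p i)) - (v' : ZMod (p i)))} :
                  Set (∀ i : Fin k, PSL(2, ZMod (p i)))),
        ∃ g₂ ∈ ({fun i => Tbar ((lam i : ZMod (p i)) - (v : ZMod (p i))),
                  fun i => Tbar ((lam i : ZMod (p i)) - (v' : ZMod (p i)))} :
                  Set (∀ i : Fin k, PSL(2, ZMod (p i)))),
        ∃ g₃ ∈ ({fun i => Tbar ((lam i : ZMod (p i)) - (v : ZMod (p i))),
                  fun i => Tbar ((lam i : ZMod (p i)) - (v' : ZMod (p i)))} :
                  Set (∀ i : Fin k, PSL(2, ZMod (p i)))),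
        ∃ g₄ ∈ ({fun i => Tbar ((lam i : ZMod (p i)) - (v : ZMod (p i))),
                  fun i => Tbar ((lam i : ZMod (p i)) - (v' : ZMod (p i)))} :
                  Set (∀ i : Fin k, PSL(2, ZMod (p i)))),
        ∃ g₅ ∈ ({fun i => Tbar ((lam i : ZMod (p i)) - (v : ZMod (p i))),
                  fun i => Tbar ((lam i : ZMod (p i)) - (v' : ZMod (p i)))} :
                  Set (∀ i : Fin k, PSL(2, ZMod (p i)))),
        ∃ g₆ ∈ ({fun i => Tbar ((lam i : ZMod (p i)) - (v : ZMod (p i))),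
                  fun i => Tbar ((lam i : ZMod (p i)) - (v' : ZMod (p i)))} :
                  Set (∀ i : Fin k, PSL(2, ZMod (p i)))),
          x = g₁ * g₂ * g₃ * g₄⁻¹ * g₅⁻¹ * g₆⁻¹} = ⊤) ∧
    (Subgroup.closure {x : ∀ i : Fin k, PSL(2, ZMod (p i)) |
        ∃ g₁ ∈ ({fun i => Tbar ((lam i : ZMod (p i)) - (v : ZMod (p i))),
                  fun i => Tbar ((lam i : ZMod (p i)) - (v' : ZMod (p i)))} :
                  Set (∀ i : Fin k, PSL(2, ZMod (p i)))),
        ∃ g₂ ∈ ({fun i => Tbar ((lam i : ZMod (p i)) - (v : ZMod (p i))),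
                  fun i => Tbar ((lam i : ZMod (p i)) - (v' : ZMod (p i)))} :
                  Set (∀ i : Fin k, PSL(2, ZMod (p i)))),
        ∃ g₃ ∈ ({fun i => Tbar ((lam i : ZMod (p i)) - (v : ZMod (p i))),
                  fun i => Tbar ((lam i : ZMod (p i)) - (v' : ZMod (p i)))} :
                  Set (∀ i : Fin k, PSL(2, ZMod (p i)))),
        ∃ g₄ ∈ ({fun i => Tbar ((lam i : ZMod (p i)) - (v : ZMod (p i))),
                  fun i => Tbar ((lam i : ZMod (p i)) - (v' : ZMod (p i)))} :
                  Set (∀ i : Fin k, PSL(2, ZMod (p i)))),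
        ∃ g₅ ∈ ({fun i => Tbar ((lam i : ZMod (p i)) - (v : ZMod (p i))),
                  fun i => Tbar ((lam i : ZMod (p i)) - (v' : ZMod (p i)))} :
                  Set (∀ i : Fin k, PSL(2, ZMod (p i)))),
        ∃ g₆ ∈ ({fun i => Tbar ((lam i : ZMod (p i)) - (v : ZMod (p i))),
                  fun i => Tbar ((lam i : ZMod (p i)) - (v' : ZMod (p i)))} :
                  Set (∀ i : Fin k, PSL(2, ZMod (p i)))),
          x = g₁⁻¹ * g₂⁻¹ * g₃⁻¹ * g₄ * g₅ * g₆} = ⊤) := by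
  have main := SL_main v v' hvv' k p hp hpC lam hlam
  set S := ({fun i => Tbar ((lam i : ZMod (p i)) - (v : ZMod (p i))),
                  fun i => Tbar ((lam i : ZMod (p i)) - (v' : ZMod (p i)))} :
                  Set (∀ i : Fin k, PSL(2, ZMod (p i)))) with hS
  let A : ∀ i : Fin k, SL(2, ZMod (p i)) := fun i => Tsl ((lam i : ZMod (p i)) - (v : ZMod (p i)))
  let B : ∀ i : Fin k, SL(2, ZMod (p i)) := fun i => Tsl ((lam i : ZMod (p i)) - (v' : ZMod (p i)))
  let f : (∀ i : Fin k, SL(2, ZMod (p i))) →* (∀ i : Fin k, PSL(2, ZMod (p i))) :=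
    MonoidHom.pi (fun i => (QuotientGroup.mk' _).comp (Pi.evalMonoidHom _ i))
  let f' : (∀ i : Fin k, SL(2, ZMod (p i))) →* (∀ i : Fin k, PSL(2, ZMod (p i))) :=
    MonoidHom.pi (fun i => (QuotientGroup.mk' _).comp ((swapHom (p i)).comp (Pi.evalMonoidHom _ i)))
  have hf : Function.Surjective f := by
    intro x
    choose y hy using fun i => QuotientGroup.mk'_surjective _ (x i)
    exact ⟨y, funext hy⟩
  have hf' : Function.Surjective f' := by
    intro x
    choose y hy using fun i => QuotientGroup.mk'_surjective _ (x i)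
    refine ⟨fun i => swapHom _ (y i), funext fun i => ?_⟩
    change QuotientGroup.mk' _ (swapHom _ (swapHom _ (y i))) = _
    rw [swapHom_swapHom, hy]
  have hSA : f A ∈ S := Or.inl rfl
  have hSB : f B ∈ S := Or.inr rfl
  have hfA : f' A = (f A)⁻¹ := by
    funext i
    change QuotientGroup.mk' _ (swapHom _ (Tsl _)) = (QuotientGroup.mk' _ (Tsl _))⁻¹
    rw [swapHom_Tsl, map_inv]
  have hfB : f' B = (f B)⁻¹ := by
    funext i
    change QuotientGroup.mk' _ (swapHom _ (Tsl _)) = (QuotientGroup.mk' _ (Tsl _))⁻¹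
    rw [swapHom_Tsl, map_inv]
  constructor
  · apply top_of_comap hf
    apply main _ A B rfl rfl
    · refine Subgroup.subset_closure ⟨_, hSA, _, hSA, _, hSA, _, hSA, _, hSA, _, hSB, ?_⟩
      simp only [map_mul, map_inv]; group
    · refine Subgroup.subset_closure ⟨_, hSA, _, hSA, _, hSA, _, hSA, _, hSB, _, hSA, ?_⟩
      simp only [map_mul, map_inv]; group
    · refine Subgroup.subset_closure ⟨_, hSA, _, hSA, _, hSA, _, hSB, _, hSA, _, hSA, ?_⟩
      simp only [map_mul, map_inv]; group
  · apply top_of_comap hf'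
    apply main _ A B rfl rfl
    · refine Subgroup.subset_closure ⟨_, hSA, _, hSA, _, hSA, _, hSA, _, hSA, _, hSB, ?_⟩
      simp only [map_mul, map_inv, hfA, hfB]; group
    · refine Subgroup.subset_closure ⟨_, hSA, _, hSA, _, hSA, _, hSA, _, hSB, _, hSA, ?_⟩
      simp only [map_mul, map_inv, hfA, hfB]; group
    · refine Subgroup.subset_closure ⟨_, hSA, _, hSA, _, hSA, _, hSB, _, hSA, _, hSA, ?_⟩
      simp only [map_mul, map_inv, hfA, hfB]; group

end
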